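/- Let $n \geq 2$ and $p \geq 1$ be integers, and for $1 \leq r \leq p$ let $(h_{ij}^r)_{1 \leq i,j \leq n}$ be real symmetric $n \times n$ matrices. Then $\sum_{r=1}^{p}\sum_{1 \leq i < j \leq n}(h_{ii}^r - h_{jj}^r)^2 + 2n\sum_{r=1}^{p}\sum_{1 \leq i < j \leq n}(h_{ij}^r)^2 \geq 2n\sqrt{\sum_{1 \leq r < s \leq p}\sum_{1 \leq i < j \leq n}\left(\sum_{k=1}^{n}(h_{jk}^r h_{ik}^s - h_{ik}^r h_{jk}^s)\right)^2}$. -/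

import Mathlib

open Finset Matrix

/-- Kronecker delta (the components of the metric in an orthonormal frame). -/
noncomputable def kdelta {k : ℕ} (a b : Fin k) : ℝ := if a = b then 1 else 0

/-- The scalar curvature `tau = sum_{i<j} R(e_i, e_j, e_j, e_i)` computed from the
components of the curvature tensor in an orthonormal frame. -/
noncomputable def scalarCurv {n : ℕ} (R : Fin n → Fin n → Fin n → Fin n → ℝ) : ℝ :=
  ∑ i : Fin n, ∑ j : Fin n, if i < j then R i j j i else 0

/-- The normalized scalar curvature `rho = 2 tau / (n (n - 1))`. -/
noncomputable def normScalarCurv {n : ℕ} (R : Fin n → Fin n → Fin n → Fin n → ℝ) : ℝ :=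
  2 * scalarCurv R / ((n : ℝ) * ((n : ℝ) - 1))

/-- The normal scalar curvature `K_N = -(1/4) sum_{r,s} trace ([A_r, A_s]^2)` computed from
the shape operators (given as symmetric matrices in an orthonormal tangent frame). -/
noncomputable def KN {n p : ℕ} (A : Fin p → Matrix (Fin n) (Fin n) ℝ) : ℝ :=
  -(1 / 4) * ∑ r : Fin p, ∑ s : Fin p,
    Matrix.trace ((A r * A s - A s * A r) * (A r * A s - A s * A r))

/-- The normalized normal scalar curvature `rho_N = (2/(n(n-1))) sqrt(K_N)`. -/
noncomputable def rhoN {n p : ℕ} (A : Fin p → Matrix (Fin n) (Fin n) ℝ) : ℝ :=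
  2 / ((n : ℝ) * ((n : ℝ) - 1)) * Real.sqrt (KN A)

/-- The squared mean curvature `|H|^2 = sum_r ((1/n) trace A_r)^2` computed from the
components of the second fundamental form in adapted orthonormal frames. -/
noncomputable def meanCurvSq {n p : ℕ} (A : Fin p → Matrix (Fin n) (Fin n) ℝ) : ℝ :=
  ∑ r : Fin p, ((1 / (n : ℝ)) * ∑ i : Fin n, A r i i) ^ 2

/-- The normalized normal scalar curvature
`rho^perp = (2/(n(n-1))) sqrt( sum_{i<j} sum_{r<s} (Rperp(e_i,e_j,v_r,v_s))^2 )`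
computed from the components of the normal curvature tensor. -/
noncomputable def rhoPerp {n p : ℕ} (Rp : Fin n → Fin n → Fin p → Fin p → ℝ) : ℝ :=
  2 / ((n : ℝ) * ((n : ℝ) - 1)) *
    Real.sqrt (∑ i : Fin n, ∑ j : Fin n, ∑ r : Fin p, ∑ s : Fin p,
      if i < j ∧ r < s then Rp i j r s ^ 2 else 0)

/-- The Ricci curvature `Ric(e_b, e_c) = sum_a R(e_a, e_b, e_c, e_a)` computed from the
components of the curvature tensor in an orthonormal frame. -/
noncomputable def ambRicci {m : ℕ} (Rt : Fin m → Fin m → Fin m → Fin m → ℝ)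
    (b c : Fin m) : ℝ :=
  ∑ a : Fin m, Rt a b c a

/-- The (ambient) scalar curvature `tau = sum_{a<b} sigma(e_a, e_b) = (1/2) sum_a Ric(e_a,e_a)`. -/
noncomputable def ambScalar {m : ℕ} (Rt : Fin m → Fin m → Fin m → Fin m → ℝ) : ℝ :=
  (1 / 2) * ∑ a : Fin m, ambRicci Rt a a

attribute [local instance] LieRing.ofAssociativeRing

variable {ι κ : Type*} [Fintype ι]

/-- The Laplacian of a star with leaves `J` is bounded by `#J + 1`. -/
theorem sum_sq_sub_le_of_notMem [DecidableEq ι] (η : ι → ℝ) {i : ι} {J : Finset ι} (hi : i ∉ J) :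
    ∑ j ∈ J, (η i - η j) ^ 2 ≤ (#J + 1) * ∑ k, η k ^ 2 := by
  have hcs : (∑ j ∈ J, η j) ^ 2 ≤ #J * ∑ j ∈ J, η j ^ 2 := sq_sum_le_card_mul_sum_sq
  have hle : η i ^ 2 + ∑ j ∈ J, η j ^ 2 ≤ ∑ k, η k ^ 2 := by
    rw [← sum_insert (f := fun k => η k ^ 2) hi]
    exact sum_le_univ_sum_of_nonneg fun k => sq_nonneg _
  have hexp : ∑ j ∈ J, (η i - η j) ^ 2
      = #J * η i ^ 2 - 2 * η i * ∑ j ∈ J, η j + ∑ j ∈ J, η j ^ 2 := by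
    simp only [sub_sq, sum_add_distrib, sum_sub_distrib, sum_const, nsmul_eq_mul, mul_sum]
  have hmul := mul_le_mul_of_nonneg_left hle (by positivity : (0 : ℝ) ≤ #J + 1)
  nlinarith [sq_nonneg (η i + ∑ j ∈ J, η j)]

/-- The ordered pairs whose gap is positive and exceeds the Euclidean norm of `η`. -/
noncomputable def largeGaps (η : ι → ℝ) : Finset (ι × ι) :=
  {e | η e.2 < η e.1 ∧ ∑ k, η k ^ 2 < (η e.1 - η e.2) ^ 2}

theorem mem_largeGaps {η : ι → ℝ} {e : ι × ι} :
    e ∈ largeGaps η ↔ η e.2 < η e.1 ∧ ∑ k, η k ^ 2 < (η e.1 - η e.2) ^ 2 := by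
  simp [largeGaps]

theorem sq_sub_le_two_mul_sum_sq [DecidableEq ι] (η : ι → ℝ) (i j : ι) :
    (η i - η j) ^ 2 ≤ 2 * ∑ k, η k ^ 2 := by
  by_cases h : i = j
  · subst h; simp [sum_nonneg, sq_nonneg]
  · have := sum_sq_sub_le_of_notMem η (i := i) (J := {j}) (by simpa using h)
    norm_num at this
    exact this

theorem largeGaps_snd_ne_fst [DecidableEq ι] {η : ι → ℝ} {e f : ι × ι} (he : e ∈ largeGaps η)
    (hf : f ∈ largeGaps η) : e.2 ≠ f.1 := by
  intro h
  rw [mem_largeGaps] at he hf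
  rw [← h] at hf
  have hb := sq_sub_le_two_mul_sum_sq η e.1 f.2
  nlinarith [mul_pos (sub_pos.2 he.1) (sub_pos.2 hf.1),
    sum_nonneg (s := univ) fun k _ => sq_nonneg (η k)]

theorem largeGaps_share_end [DecidableEq ι] {η : ι → ℝ} {e f : ι × ι} (he : e ∈ largeGaps η)
    (hf : f ∈ largeGaps η) : e.1 = f.1 ∨ e.2 = f.2 := by
  by_contra! h
  have hee := largeGaps_snd_ne_fst he he
  have hef := largeGaps_snd_ne_fst he hf
  have hfe := largeGaps_snd_ne_fst hf he
  have hff := largeGaps_snd_ne_fst hf hf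
  rw [mem_largeGaps] at he hf
  have hle : ∑ k ∈ {e.1, e.2, f.1, f.2}, η k ^ 2 ≤ ∑ k, η k ^ 2 :=
    sum_le_univ_sum_of_nonneg fun k => sq_nonneg _
  rw [sum_insert (by simp [hee.symm, h.1, hfe.symm]), sum_insert (by simp [hef, h.2]),
    sum_insert (by simp [hff.symm]), sum_singleton] at hle
  nlinarith [sq_nonneg (η e.1 + η e.2), sq_nonneg (η f.1 + η f.2)]

theorem largeGaps_subset_star [DecidableEq ι] (η : ι → ℝ) {e : ι × ι} (he : e ∈ largeGaps η) :
    (∀ f ∈ largeGaps η, f.1 = e.1) ∨ ∀ f ∈ largeGaps η, f.2 = e.2 := by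
  by_contra! h
  obtain ⟨⟨f, hf, hfe⟩, g, hg, hge⟩ := h
  have h1 := (largeGaps_share_end he hf).resolve_left hfe.symm
  have h2 := (largeGaps_share_end he hg).resolve_right hge.symm
  rcases largeGaps_share_end hf hg with h3 | h3
  · exact hfe (h3.trans h2.symm)
  · exact hge (h3.symm.trans h1.symm)

theorem sum_largeGaps_le [DecidableEq ι] (η : ι → ℝ) :
    ∑ e ∈ largeGaps η, ((η e.1 - η e.2) ^ 2 - ∑ k, η k ^ 2) ≤ ∑ k, η k ^ 2 := by
  rcases (largeGaps η).eq_empty_or_nonempty with h | ⟨e, he⟩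
  · rw [h, sum_empty]
    exact sum_nonneg fun k _ => sq_nonneg _
  rw [sum_sub_distrib, sum_const, nsmul_eq_mul]
  rcases largeGaps_subset_star η he with hs | hs
  · have hinj : Set.InjOn Prod.snd (largeGaps η : Set (ι × ι)) := fun f hf g hg hfg =>
      Prod.ext ((hs f hf).trans (hs g hg).symm) hfg
    have hmem : e.1 ∉ (largeGaps η).image Prod.snd := by
      simp only [mem_image, not_exists, not_and]
      exact fun f hf => largeGaps_snd_ne_fst hf he
    have hb := sum_sq_sub_le_of_notMem η hmem
    rw [sum_image hinj, card_image_of_injOn hinj] at hb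
    rw [sum_congr rfl fun f hf => by rw [hs f hf]]
    linarith
  · have hinj : Set.InjOn Prod.fst (largeGaps η : Set (ι × ι)) := fun f hf g hg hfg =>
      Prod.ext hfg ((hs f hf).trans (hs g hg).symm)
    have hmem : e.2 ∉ (largeGaps η).image Prod.fst := by
      simp only [mem_image, not_exists, not_and]
      exact fun f hf h => largeGaps_snd_ne_fst he hf h.symm
    have hb := sum_sq_sub_le_of_notMem η hmem
    rw [sum_image hinj, card_image_of_injOn hinj] at hb
    rw [sum_congr rfl fun f hf => by rw [hs f hf, sub_sq_comm]]
    linarith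

/-- **Lu's weighted gap inequality**, homogeneous form. -/
theorem sum_sq_sub_mul_le [DecidableEq ι] (η : ι → ℝ) (r : ι → ι → ℝ) {M : ℝ} (hr : ∀ i j, 0
    ≤ r i j)
    (hM₀ : 0 ≤ M) (hM : ∀ i j, i ≠ j → r i j ≤ M) :
    ∑ i, ∑ j, (η i - η j) ^ 2 * r i j
      ≤ (∑ k, η k ^ 2) * (∑ i, ∑ j, r i j + 2 * M) := by
  set N := ∑ k, η k ^ 2 with hN
  have hN₀ : 0 ≤ N := sum_nonneg fun k _ => sq_nonneg _
  set g : ι → ι → ℝ := fun i j => if (i, j) ∈ largeGaps η then (η i - η j) ^ 2 - N else 0 with hg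
  have hg₀ : ∀ i j, 0 ≤ g i j := fun i j => by
    simp only [hg]
    split_ifs with h
    · exact (sub_pos.2 (mem_largeGaps.1 h).2).le
    · exact le_rfl
  have hgsum : ∑ i, ∑ j, g i j ≤ N := by
    rw [← Fintype.sum_prod_type', ← sum_filter, filter_mem_eq_inter, univ_inter]
    exact sum_largeGaps_le η
  have hpoint : ∀ i j, (η i - η j) ^ 2 * r i j ≤ N * r i j + M * (g i j + g j i) := fun i j => by
    have hrhs := mul_nonneg hM₀ (add_nonneg (hg₀ i j) (hg₀ j i))
    by_cases hle : (η i - η j) ^ 2 ≤ N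
    · nlinarith [mul_le_mul_of_nonneg_right hle (hr i j)]
    · push Not at hle
      have hij : i ≠ j := by
        rintro rfl
        simp only [sub_self] at hle
        linarith
      have hgap : (η i - η j) ^ 2 - N ≤ g i j + g j i := by
        have hne : η i ≠ η j := by
          intro h
          simp only [h, sub_self] at hle
          linarith
        rcases hne.lt_or_gt with h | h
        · have hmem : (j, i) ∈ largeGaps η := mem_largeGaps.2 ⟨h, by rwa [sub_sq_comm]⟩
          have hval : g j i = (η i - η j) ^ 2 - N := by simp only [hg, if_pos hmem, sub_sq_comm]
          linarith [hg₀ i j]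
        · have hmem : (i, j) ∈ largeGaps η := mem_largeGaps.2 ⟨h, hle⟩
          have hval : g i j = (η i - η j) ^ 2 - N := by simp only [hg, if_pos hmem]
          linarith [hg₀ j i]
      nlinarith [mul_le_mul (hM i j hij) hgap (sub_pos.2 hle).le hM₀]
  calc ∑ i, ∑ j, (η i - η j) ^ 2 * r i j
      ≤ ∑ i, ∑ j, (N * r i j + M * (g i j + g j i)) :=
        sum_le_sum fun i _ => sum_le_sum fun j _ => hpoint i j
    _ = N * ∑ i, ∑ j, r i j + M * (2 * ∑ i, ∑ j, g i j) := by
        simp only [sum_add_distrib, ← mul_sum]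
        rw [sum_comm (f := fun i j => g j i)]
        ring
    _ ≤ N * (∑ i, ∑ j, r i j + 2 * M) := by nlinarith

/-- A quadratic form is bounded by `(∑ x)²` on the nonnegative orthant as soon as the rows indexed by
a largest coordinate are bounded by `∑ x`; proved at a maximizer on the standard simplex. -/
theorem sum_mul_mul_le_sq_sum_of_row_le [Fintype κ] [DecidableEq κ] (C : κ → κ → ℝ)
    (hsymm : ∀ a b, C a b = C b a)
    (hdiag : ∀ a, C a a = 0)
    (hrow : ∀ x : κ → ℝ, (∀ b, 0 ≤ x b) → ∀ a, (∀ b, x b ≤ x a) → ∑ b, C a b * x b ≤ ∑ b, x b)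
    (x : κ → ℝ) (hx : ∀ b, 0 ≤ x b) :
    ∑ a, ∑ b, C a b * (x a * x b) ≤ (∑ a, x a) ^ 2 := by
  set f : (κ → ℝ) → ℝ := fun y => ∑ a, ∑ b, C a b * (y a * y b) with hf
  rcases isEmpty_or_nonempty κ with hκ | hκ
  · simp
  have hcont : Continuous f := by fun_prop
  have hsmul : ∀ (t : ℝ) y, f (t • y) = t ^ 2 * f y := fun t y => by
    simp only [hf, Pi.smul_apply, smul_eq_mul, mul_sum]
    exact sum_congr rfl fun a _ => sum_congr rfl fun b _ => by ring
  obtain ⟨z, hz, hmax⟩ := (isCompact_stdSimplex ℝ κ).exists_isMaxOn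
    ⟨_, single_mem_stdSimplex ℝ (Classical.arbitrary κ)⟩ hcont.continuousOn
  have hhom : ∀ y : κ → ℝ, (∀ b, 0 ≤ y b) → f y ≤ f z * (∑ b, y b) ^ 2 := fun y hy => by
    rcases (sum_nonneg fun b _ => hy b : 0 ≤ ∑ b, y b).eq_or_lt with h0 | h0
    · have hy0 : y = 0 := funext fun b =>
        (sum_eq_zero_iff_of_nonneg fun b _ => hy b).1 h0.symm b (mem_univ b)
      simp [hy0, f]
    · have hmem : (∑ b, y b)⁻¹ • y ∈ stdSimplex ℝ κ :=
        ⟨fun b => mul_nonneg (inv_nonneg.2 h0.le) (hy b), by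
          simp only [Pi.smul_apply, smul_eq_mul, ← mul_sum]; exact inv_mul_cancel₀ h0.ne'⟩
      have hle : f ((∑ b, y b)⁻¹ • y) ≤ f z := hmax hmem
      rw [hsmul, inv_pow, inv_mul_le_iff₀ (by positivity)] at hle
      linarith
  suffices hone : f z ≤ 1 by
    nlinarith [hhom x hx, sq_nonneg (∑ a, x a)]
  by_contra! hlt
  obtain ⟨a, -, ha⟩ := exists_max_image univ z univ_nonempty
  have hza : 0 < z a := by
    by_contra! h
    have : ∑ b, z b ≤ 0 := sum_nonpos fun b hb => (ha b hb).trans h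
    linarith [hz.2]
  have hrz := hrow z hz.1 a fun b => ha b (mem_univ b)
  rw [hz.2] at hrz
  set t := min (z a) ((f z - 1) / f z)
  have ht : 0 < t := lt_min hza (div_pos (by linarith) (by linarith))
  have hta : t ≤ z a := min_le_left _ _
  have htf : f z * t ≤ f z - 1 := by
    rw [mul_comm, ← le_div_iff₀ (by linarith)]; exact min_le_right _ _
  have hpert := hhom (z - Pi.single a t) fun b => by
    by_cases hb : b = a
    · subst hb; simpa using hta
    · simpa [hb] using hz.1 b
  have hsum : ∑ b, (z - Pi.single a t : κ → ℝ) b = 1 - t := by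
    simp [sum_sub_distrib, hz.2]
  have hval : f (z - Pi.single a t) = f z - 2 * t * ∑ b, C a b * z b := by
    have hcross : ∑ b, C b a * z b = ∑ b, C a b * z b :=
      sum_congr rfl fun b _ => by rw [hsymm]
    have hexp : ∀ b c, C b c * ((z - Pi.single a t : κ → ℝ) b * (z - Pi.single a t : κ → ℝ) c)
        = C b c * (z b * z c) - (Pi.single a t : κ → ℝ) b * (C b c * z c)
          - (Pi.single a t : κ → ℝ) c * (C b c * z b)
          + (Pi.single a t : κ → ℝ) b * ((Pi.single a t : κ → ℝ) c * C b c) := fun b c => by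
      simp only [Pi.sub_apply]; ring
    simp only [hf, hexp, sum_add_distrib, sum_sub_distrib, ← mul_sum]
    simp only [Pi.single_apply, ite_mul, zero_mul, sum_ite_eq', mem_univ, if_true, hdiag, ← mul_sum,
      hcross]
    ring
  rw [hsum, hval] at hpert
  nlinarith

/-- The squared Frobenius norm of a real matrix. -/
def frobSq (A : Matrix ι ι ℝ) : ℝ := ∑ i, ∑ j, A i j ^ 2

theorem frobSq_nonneg (A : Matrix ι ι ℝ) : 0 ≤ frobSq A :=
  sum_nonneg fun _ _ => sum_nonneg fun _ _ => sq_nonneg _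

theorem trace_transpose_mul_eq_sum (A B : Matrix ι ι ℝ) :
    trace (Aᵀ * B) = ∑ i, ∑ j, A i j * B i j := by
  simp only [trace, diag_apply, mul_apply, transpose_apply]
  exact sum_comm

theorem trace_transpose_mul_self (A : Matrix ι ι ℝ) : trace (Aᵀ * A) = frobSq A := by
  simp only [trace_transpose_mul_eq_sum, frobSq, sq]

theorem frobSq_smul (t : ℝ) (A : Matrix ι ι ℝ) : frobSq (t • A) = t ^ 2 * frobSq A := by
  simp only [frobSq, Matrix.smul_apply, smul_eq_mul, mul_pow, mul_sum]

theorem frobSq_lie_comm [DecidableEq ι] (A B : Matrix ι ι ℝ) : frobSq ⁅A, B⁆ = frobSq ⁅B, A⁆ := by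
  rw [← lie_skew, ← neg_one_smul ℝ, frobSq_smul]
  norm_num

theorem exists_orthogonal_diagonalization [DecidableEq ι] {A : Matrix ι ι ℝ} (hA : A.IsSymm) :
    ∃ (W : Matrix ι ι ℝ) (η : ι → ℝ), Wᵀ * W = 1 ∧ W * Wᵀ = 1 ∧ Wᵀ * A * W = diagonal η := by
  have hH : A.IsHermitian := by rwa [IsHermitian, conjTranspose_eq_transpose_of_trivial]
  have hU := hH.eigenvectorUnitary.2
  rw [mem_unitaryGroup_iff, star_eq_conjTranspose, conjTranspose_eq_transpose_of_trivial] at hU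
  have hU' := mul_eq_one_comm.1 hU
  refine ⟨hH.eigenvectorUnitary, hH.eigenvalues, hU', hU, ?_⟩
  have hs := hH.spectral_theorem
  rw [Unitary.conjStarAlgAut_apply, star_eq_conjTranspose,
    conjTranspose_eq_transpose_of_trivial] at hs
  generalize (hH.eigenvectorUnitary : Matrix ι ι ℝ) = W at hs hU' ⊢
  calc Wᵀ * A * W = (Wᵀ * W) * diagonal hH.eigenvalues * (Wᵀ * W) := by
        conv_lhs => rw [hs]
        simp only [Matrix.mul_assoc]
        rfl
    _ = diagonal hH.eigenvalues := by rw [hU', Matrix.one_mul, Matrix.mul_one]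

theorem trace_transpose_mul_conj [DecidableEq ι] {W : Matrix ι ι ℝ} (hW : W * Wᵀ = 1)
    (A B : Matrix ι ι ℝ) :
    trace ((Wᵀ * A * W)ᵀ * (Wᵀ * B * W)) = trace (Aᵀ * B) := by
  have : (Wᵀ * A * W)ᵀ * (Wᵀ * B * W) = Wᵀ * (Aᵀ * ((W * Wᵀ) * (B * W))) := by
    simp only [transpose_mul, transpose_transpose, Matrix.mul_assoc]
  rw [this, hW, Matrix.one_mul, trace_mul_comm]
  simp only [Matrix.mul_assoc, hW, Matrix.mul_one]

theorem frobSq_conj [DecidableEq ι] {W : Matrix ι ι ℝ} (hW : W * Wᵀ = 1) (A : Matrix ι ι ℝ) :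
    frobSq (Wᵀ * A * W) = frobSq A := by
  rw [← trace_transpose_mul_self, trace_transpose_mul_conj hW, trace_transpose_mul_self]

theorem lie_conj [DecidableEq ι] {W : Matrix ι ι ℝ} (hW : W * Wᵀ = 1) (A B : Matrix ι ι ℝ) :
    ⁅Wᵀ * A * W, Wᵀ * B * W⁆ = Wᵀ * ⁅A, B⁆ * W := by
  have h : ∀ A B : Matrix ι ι ℝ, Wᵀ * A * W * (Wᵀ * B * W) = Wᵀ * (A * B) * W := fun A B => by
    calc Wᵀ * A * W * (Wᵀ * B * W) = Wᵀ * A * (W * Wᵀ) * B * W := by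
          simp only [Matrix.mul_assoc]
      _ = Wᵀ * (A * B) * W := by rw [hW]; simp only [Matrix.mul_assoc, Matrix.one_mul]
  rw [Ring.lie_def, Ring.lie_def, h, h, Matrix.mul_sub, Matrix.sub_mul]

theorem frobSq_diagonal [DecidableEq ι] (η : ι → ℝ) : frobSq (diagonal η) = ∑ i, η i ^ 2 := by
  simp [frobSq, diagonal_apply, ite_pow]

theorem frobSq_lie_diagonal [DecidableEq ι] (η : ι → ℝ) (B : Matrix ι ι ℝ) :
    frobSq ⁅diagonal η, B⁆ = ∑ i, ∑ j, (η i - η j) ^ 2 * B i j ^ 2 := by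
  refine sum_congr rfl fun i _ => sum_congr rfl fun j _ => ?_
  rw [Ring.lie_def, Matrix.sub_apply, diagonal_mul, mul_diagonal]
  ring

theorem two_mul_sq_apply_le_frobSq [DecidableEq ι] {B : Matrix ι ι ℝ} (hB : B.IsSymm) {i j : ι}
    (hij : i ≠ j) :
    2 * B i j ^ 2 ≤ frobSq B := by
  have hsub : ∑ e ∈ ({(i, j), (j, i)} : Finset (ι × ι)), B e.1 e.2 ^ 2
    ≤ ∑ e : ι × ι, B e.1 e.2 ^ 2 :=
    sum_le_univ_sum_of_nonneg fun e => sq_nonneg _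
  rw [sum_pair (by simp [hij]), Fintype.sum_prod_type, hB.apply i j] at hsub
  rw [frobSq]
  linarith

theorem frobSq_sum_smul_of_orthogonal (s : Finset κ) (c : κ → ℝ) {B : κ → Matrix ι ι ℝ}
    (horth : ∀ a b, a ≠ b → trace ((B a)ᵀ * B b) = 0) :
    frobSq (∑ a ∈ s, c a • B a) = ∑ a ∈ s, c a ^ 2 * frobSq (B a) := by
  rw [← trace_transpose_mul_self, transpose_sum, sum_mul, trace_sum]
  refine sum_congr rfl fun a ha => ?_
  rw [mul_sum, trace_sum, sum_eq_single_of_mem a ha]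
  · rw [transpose_smul, smul_mul_smul_comm, trace_smul, trace_transpose_mul_self, smul_eq_mul, sq]
  · intro b _ hba
    rw [transpose_smul, smul_mul_smul_comm, trace_smul, horth a b hba.symm, smul_zero]

/-- Bessel's inequality for the normalized symmetric matrix unit at `(i, j)`. -/
theorem two_mul_sum_sq_apply_le [DecidableEq ι] (s : Finset κ) {B : κ → Matrix ι ι ℝ} (hB : ∀ a,
    (B a).IsSymm)
    (horth : ∀ a b, a ≠ b → trace ((B a)ᵀ * B b) = 0) {m : ℝ} (hm₀ : 0 ≤ m)
    (hm : ∀ a ∈ s, frobSq (B a) ≤ m) {i j : ι} (hij : i ≠ j) :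
    2 * ∑ a ∈ s, B a i j ^ 2 ≤ m := by
  set R := ∑ a ∈ s, B a i j ^ 2 with hR
  have hsymm : (∑ a ∈ s, B a i j • B a).IsSymm := by
    simp only [IsSymm, transpose_sum, transpose_smul, (hB _).eq]
  have hle := two_mul_sq_apply_le_frobSq hsymm hij
  have happ : (∑ a ∈ s, B a i j • B a) i j = R := by
    simp only [Matrix.sum_apply, Matrix.smul_apply, smul_eq_mul, hR, sq]
  have hub : ∑ a ∈ s, B a i j ^ 2 * frobSq (B a) ≤ R * m := by
    rw [hR, sum_mul]
    exact sum_le_sum fun a ha => mul_le_mul_of_nonneg_left (hm a ha) (sq_nonneg _)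
  rw [happ, frobSq_sum_smul_of_orthogonal s _ horth] at hle
  rcases (sum_nonneg fun a _ => sq_nonneg _ : 0 ≤ R).eq_or_lt with h0 | h0
  · rw [hR, ← h0]; linarith
  · nlinarith

theorem sum_frobSq_lie_diagonal_le [DecidableEq ι] (η : ι → ℝ) (s : Finset κ) {B : κ → Matrix ι ι ℝ}
    (hB : ∀ a, (B a).IsSymm) (horth : ∀ a b, a ≠ b → trace ((B a)ᵀ * B b) = 0) {m : ℝ}
    (hm₀ : 0 ≤ m) (hm : ∀ a ∈ s, frobSq (B a) ≤ m) :
    ∑ a ∈ s, frobSq ⁅diagonal η, B a⁆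
      ≤ frobSq (diagonal η) * (∑ a ∈ s, frobSq (B a) + m) := by
  have h := sum_sq_sub_mul_le η (fun i j => ∑ a ∈ s, B a i j ^ 2) (M := m / 2)
    (fun i j => sum_nonneg fun a _ => sq_nonneg _) (by linarith)
    fun i j hij => by linarith [two_mul_sum_sq_apply_le s hB horth hm₀ hm hij]
  have hswap : ∀ f : κ → ι → ι → ℝ,
      ∑ i, ∑ j, ∑ a ∈ s, f a i j = ∑ a ∈ s, ∑ i, ∑ j, f a i j := fun f => by
    rw [sum_comm]
    simp only [sum_comm (s := univ) (t := s)]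
    exact sum_congr rfl fun a _ => sum_comm
  simp only [mul_sum (s := s), hswap] at h
  simp only [frobSq_lie_diagonal, frobSq_diagonal]
  simp only [frobSq]
  linarith

theorem sum_frobSq_lie_le [DecidableEq ι] {A : Matrix ι ι ℝ} (hA : A.IsSymm) (s : Finset κ)
    {B : κ → Matrix ι ι ℝ} (hB : ∀ a, (B a).IsSymm)
    (horth : ∀ a b, a ≠ b → trace ((B a)ᵀ * B b) = 0) {m : ℝ} (hm₀ : 0 ≤ m)
    (hm : ∀ a ∈ s, frobSq (B a) ≤ m) :
    ∑ a ∈ s, frobSq ⁅A, B a⁆ ≤ frobSq A * (∑ a ∈ s, frobSq (B a) + m) := by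
  obtain ⟨W, η, -, hW, hd⟩ := exists_orthogonal_diagonalization hA
  have h := sum_frobSq_lie_diagonal_le η s (B := fun a => Wᵀ * B a * W)
    (fun a => by simp only [IsSymm, transpose_mul, transpose_transpose, (hB a).eq,
      Matrix.mul_assoc])
    (fun a b hab => by rw [trace_transpose_mul_conj hW, horth a b hab]) hm₀
    (fun a ha => by rw [frobSq_conj hW]; exact hm a ha)
  simpa only [← hd, lie_conj hW, frobSq_conj hW] using h

theorem sum_sum_frobSq_lie_le_of_orthogonal [DecidableEq ι] [Fintype κ] [DecidableEq κ]
    {A : κ → Matrix ι ι ℝ} (hA : ∀ a, (A a).IsSymm)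
    (horth : ∀ a b, a ≠ b → trace ((A a)ᵀ * A b) = 0) :
    ∑ a, ∑ b, frobSq ⁅A a, A b⁆ ≤ (∑ a, frobSq (A a)) ^ 2 := by
  set U : κ → Matrix ι ι ℝ := fun a => (√(frobSq (A a)))⁻¹ • A a with hU
  have hUle : ∀ a, frobSq (U a) ≤ 1 := fun a => by
    rw [hU, frobSq_smul, inv_pow, Real.sq_sqrt (frobSq_nonneg _)]
    exact inv_mul_le_one
  have hAU : ∀ a, A a = √(frobSq (A a)) • U a := fun a => by
    by_cases h : frobSq (A a) = 0
    · have hz : A a = 0 := by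
        ext i j
        have h1 := (sum_eq_zero_iff_of_nonneg fun i _ => sum_nonneg fun j _ =>
          sq_nonneg (A a i j)).1 h i (mem_univ i)
        have h2 := (sum_eq_zero_iff_of_nonneg fun j _ => sq_nonneg (A a i j)).1 h1 j (mem_univ j)
        simpa using h2
      simp [hU, hz]
    · rw [hU, smul_smul, mul_inv_cancel₀ (by rwa [Real.sqrt_ne_zero (frobSq_nonneg _)]), one_smul]
  have hlie : ∀ (s t : ℝ) (X Y : Matrix ι ι ℝ), 0 ≤ s → 0 ≤ t →
      frobSq ⁅√s • X, √t • Y⁆ = frobSq ⁅X, Y⁆ * (s * t) := fun s t X Y hs ht => by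
    rw [smul_lie, lie_smul, frobSq_smul, frobSq_smul, Real.sq_sqrt hs, Real.sq_sqrt ht]
    ring
  have hmain := sum_mul_mul_le_sq_sum_of_row_le (fun a b => frobSq ⁅U a, U b⁆)
    (fun a b => frobSq_lie_comm _ _) (fun a => by simp [frobSq]) ?_ (fun a => frobSq (A a))
    fun a => frobSq_nonneg _
  · convert hmain using 4 with a _ b _
    conv_lhs => rw [hAU a, hAU b]
    exact hlie _ _ _ _ (frobSq_nonneg _) (frobSq_nonneg _)
  intro x hx a ha
  have hsq : ∀ b, frobSq (√(x b) • U b) ≤ x b := fun b => by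
    rw [frobSq_smul, Real.sq_sqrt (hx b)]
    exact mul_le_of_le_one_right (hx b) (hUle b)
  have hrow := sum_frobSq_lie_le (A := U a) ((hA a).smul _) (univ.erase a)
    (B := fun b => √(x b) • U b) (fun b => ((hA b).smul _).smul _)
    (fun b c hbc => by simp [hU, horth b c hbc]) (hx a) fun b _ => (hsq b).trans (ha b)
  calc ∑ b, frobSq ⁅U a, U b⁆ * x b = ∑ b ∈ univ.erase a, frobSq ⁅U a, √(x b) • U b⁆ := by
        rw [← add_sum_erase univ _ (mem_univ a), lie_self]
        simp only [lie_smul, frobSq_smul, Real.sq_sqrt (hx _)]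
        simp [frobSq, mul_comm]
    _ ≤ frobSq (U a) * (∑ b ∈ univ.erase a, frobSq (√(x b) • U b) + x a) := hrow
    _ ≤ 1 * (∑ b ∈ univ.erase a, x b + x a) := by
        refine mul_le_mul (hUle a) (by gcongr with b; exact hsq b) ?_ zero_le_one
        exact add_nonneg (sum_nonneg fun b _ => frobSq_nonneg _) (hx a)
    _ = ∑ b, x b := by rw [one_mul, sum_erase_add _ _ (mem_univ a)]

theorem sum_sq_sum_mul_eq [Fintype κ] [DecidableEq κ] {Q : Matrix κ κ ℝ} (hQ : Q * Qᵀ = 1)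
    (v : κ → ℝ) :
    ∑ a, (∑ b, Q b a * v b) ^ 2 = ∑ b, v b ^ 2 := by
  have h : ∀ w : κ → ℝ, ∑ a, w a ^ 2 = w ⬝ᵥ w := fun w => by simp only [dotProduct, sq]
  have hv : (fun a => ∑ b, Q b a * v b) = Qᵀ *ᵥ v := rfl
  rw [h (fun a => ∑ b, Q b a * v b), h v, hv, dotProduct_mulVec, vecMul_transpose, mulVec_mulVec,
    hQ, one_mulVec]

theorem sum_frobSq_sum_smul_eq [Fintype κ] [DecidableEq κ] {Q : Matrix κ κ ℝ} (hQ : Q * Qᵀ = 1)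
    (X : κ → Matrix ι ι ℝ) :
    ∑ a, frobSq (∑ b, Q b a • X b) = ∑ b, frobSq (X b) := by
  have hswap : ∀ f : κ → ι → ι → ℝ,
      ∑ a, ∑ i, ∑ j, f a i j = ∑ i, ∑ j, ∑ a, f a i j := fun f => by
    rw [sum_comm]
    exact sum_congr rfl fun i _ => sum_comm
  simp only [frobSq, Matrix.sum_apply, Matrix.smul_apply, smul_eq_mul, hswap, sum_sq_sum_mul_eq hQ]

/-- The **DDVV inequality** for a finite family of real symmetric matrices. -/
theorem sum_sum_frobSq_lie_le [DecidableEq ι] [Fintype κ] [DecidableEq κ] {A : κ → Matrix ι ι ℝ}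
    (hA : ∀ a, (A a).IsSymm) :
    ∑ a, ∑ b, frobSq ⁅A a, A b⁆ ≤ (∑ a, frobSq (A a)) ^ 2 := by
  obtain ⟨Q, η, -, hQ, hd⟩ := exists_orthogonal_diagonalization
    (A := (of fun a b => trace ((A a)ᵀ * A b) : Matrix κ κ ℝ)) (by
      ext a b
      rw [transpose_apply, of_apply, of_apply, ← trace_transpose, transpose_mul,
        transpose_transpose])
  have horth : ∀ a b, a ≠ b →
      trace ((∑ c, Q c a • A c)ᵀ * ∑ c, Q c b • A c) = 0 := fun a b hab => by
    have hab' := congrFun (congrFun hd a) b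
    rw [diagonal_apply_ne _ hab] at hab'
    rw [← hab']
    simp only [mul_apply, transpose_apply, of_apply, transpose_sum, transpose_smul, sum_mul,
      mul_sum, trace_sum, smul_mul_smul_comm, trace_smul, smul_eq_mul]
    exact sum_congr rfl fun c _ => sum_congr rfl fun d _ => by ring
  have h := sum_sum_frobSq_lie_le_of_orthogonal (A := fun a => ∑ c, Q c a • A c)
    (fun a => by simp only [IsSymm, transpose_sum, transpose_smul, (hA _).eq]) horth
  rw [sum_frobSq_sum_smul_eq hQ] at h
  simp only [lie_sum, lie_smul, sum_frobSq_sum_smul_eq hQ] at h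
  rw [sum_comm] at h
  simp only [frobSq_lie_comm (∑ c, _ • A c), lie_sum, lie_smul, sum_frobSq_sum_smul_eq hQ] at h
  exact h

theorem two_mul_sum_sum_lt [LinearOrder ι] (f : ι → ι → ℝ) (hf : ∀ i j, f i j = f j i) :
    2 * ∑ i, ∑ j, (if i < j then f i j else 0) = ∑ i, ∑ j, f i j - ∑ i, f i i := by
  have hsplit : ∀ i j, f i j = (if i < j then f i j else 0) + (if j < i then f j i else 0)
      + if i = j then f i i else 0 := fun i j => by
    rcases lt_trichotomy i j with h | rfl | h
    · simp [h, h.not_gt, h.ne]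
    · simp
    · simp [h, h.not_gt, h.ne', hf i j]
  have hsum : ∑ i, ∑ j, f i j = ∑ i, ∑ j, ((if i < j then f i j else 0)
      + (if j < i then f j i else 0) + if i = j then f i i else 0) :=
    sum_congr rfl fun i _ => sum_congr rfl fun j _ => hsplit i j
  simp only [sum_add_distrib, sum_ite_eq, mem_univ, if_true] at hsum
  rw [sum_comm (f := fun i j => if j < i then f j i else 0)] at hsum
  linarith

theorem frobSq_sub_smul_one [DecidableEq ι] (A : Matrix ι ι ℝ) (c : ℝ) :
    frobSq (A - c • (1 : Matrix ι ι ℝ))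
      = frobSq A - 2 * c * trace A + c ^ 2 * Fintype.card ι := by
  rw [← trace_transpose_mul_self, ← trace_transpose_mul_self]
  simp only [transpose_sub, transpose_smul, transpose_one, Matrix.sub_mul, Matrix.mul_sub,
    Matrix.smul_mul, Matrix.mul_smul, Matrix.one_mul, Matrix.mul_one, trace_sub, trace_smul,
    trace_transpose, trace_one, smul_eq_mul]
  ring

theorem card_mul_frobSq_traceless [LinearOrder ι] [Nonempty ι] {A : Matrix ι ι ℝ}
    (hA : A.IsSymm) :
    Fintype.card ι * frobSq (A - (trace A / Fintype.card ι) • (1 : Matrix ι ι ℝ))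
      = ∑ i, ∑ j, (if i < j then (A i i - A j j) ^ 2 else 0)
        + 2 * Fintype.card ι * ∑ i, ∑ j, (if i < j then A i j ^ 2 else 0) := by
  have hdiag := two_mul_sum_sum_lt (fun i j => (A i i - A j j) ^ 2) fun i j => sub_sq_comm _ _
  have hoff := two_mul_sum_sum_lt (fun i j => A i j ^ 2) fun i j => by rw [hA.apply]
  have hexp : ∑ i, ∑ j, (A i i - A j j) ^ 2
      = 2 * Fintype.card ι * ∑ i, A i i ^ 2 - 2 * trace A ^ 2 := by
    simp only [sub_sq, sum_add_distrib, sum_sub_distrib, ← mul_sum, ← sum_mul, sum_const,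
      card_univ, nsmul_eq_mul, trace, diag_apply]
    ring
  have hcard : (Fintype.card ι : ℝ) ≠ 0 := Nat.cast_ne_zero.2 Fintype.card_ne_zero
  have hfrob : ∑ i, ∑ j, A i j ^ 2 = frobSq A := rfl
  rw [hexp] at hdiag
  rw [hfrob] at hoff
  simp only [sub_self, ne_eq, OfNat.ofNat_ne_zero, not_false_eq_true, zero_pow, sum_const_zero,
    sub_zero] at hdiag
  rw [frobSq_sub_smul_one, mul_right_comm (2 : ℝ) (Fintype.card ι : ℝ), hoff]
  field_simp
  linarith

theorem lie_sub_smul_one [DecidableEq ι] (A B : Matrix ι ι ℝ) (c d : ℝ) :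
    ⁅A - c • (1 : Matrix ι ι ℝ), B - d • (1 : Matrix ι ι ℝ)⁆ = ⁅A, B⁆ := by
  simp only [Ring.lie_def, Matrix.sub_mul, Matrix.mul_sub, Matrix.smul_mul, Matrix.mul_smul,
    Matrix.one_mul, Matrix.mul_one]
  module

theorem lie_apply_swap [DecidableEq ι] {A B : Matrix ι ι ℝ} (hA : A.IsSymm) (hB : B.IsSymm)
    (i j : ι) : ⁅A, B⁆ j i = -⁅A, B⁆ i j := by
  have h : ⁅A, B⁆ᵀ = -⁅A, B⁆ := by
    rw [Ring.lie_def, transpose_sub, transpose_mul, transpose_mul, hA.eq, hB.eq, neg_sub]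
  exact congrFun (congrFun h i) j

theorem two_mul_sum_lt_sq_lie_apply [LinearOrder ι] {A B : Matrix ι ι ℝ} (hA : A.IsSymm)
    (hB : B.IsSymm) :
    2 * ∑ i, ∑ j, (if i < j then ⁅A, B⁆ i j ^ 2 else 0) = frobSq ⁅A, B⁆ := by
  rw [two_mul_sum_sum_lt (fun i j => ⁅A, B⁆ i j ^ 2) fun i j => by
    rw [lie_apply_swap hA hB j i, neg_sq]]
  have hzero : ∀ i, ⁅A, B⁆ i i = 0 := fun i => by linarith [lie_apply_swap hA hB i i]
  simp [hzero, frobSq]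

theorem four_mul_sum_lt_sq_lie_apply [LinearOrder ι] [Fintype κ] [LinearOrder κ]
    {A : κ → Matrix ι ι ℝ}
    (hA : ∀ a, (A a).IsSymm) :
    4 * ∑ a, ∑ b, ∑ i, ∑ j, (if a < b ∧ i < j then ⁅A a, A b⁆ i j ^ 2 else 0)
      = ∑ a, ∑ b, frobSq ⁅A a, A b⁆ := by
  have hinner : ∀ a b, 2 * ∑ i, ∑ j, (if a < b ∧ i < j then ⁅A a, A b⁆ i j ^ 2 else 0)
      = if a < b then frobSq ⁅A a, A b⁆ else 0 := fun a b => by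
    by_cases hab : a < b
    · simp only [hab, true_and, if_true, two_mul_sum_lt_sq_lie_apply (hA a) (hA b)]
    · simp [hab]
  have houter := two_mul_sum_sum_lt (fun a b => frobSq ⁅A a, A b⁆) fun a b => frobSq_lie_comm _ _
  simp only [← hinner, ← mul_sum, lie_self] at houter
  have hzero : frobSq (0 : Matrix ι ι ℝ) = 0 := by simp [frobSq]
  rw [hzero, sum_const_zero, sub_zero] at houter
  linarith

/-- **Lu's algebraic inequality (equivalent to the DDVV conjecture).**
For symmetric `n × n` real matrices `h 1, …, h p` (`n ≥ 2`, `p ≥ 1`),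
`∑_r ∑_{i<j} (h^r_ii - h^r_jj)² + 2n ∑_r ∑_{i<j} (h^r_ij)²
  ≥ 2n √( ∑_{r<s} ∑_{i<j} ( ∑_k (h^r_jk h^s_ik - h^r_ik h^s_jk) )² )`. -/
theorem lu_inequality {n p : ℕ} (hn : 2 ≤ n) (hp : 1 ≤ p)
    (h : Fin p → Matrix (Fin n) (Fin n) ℝ) (hsymm : ∀ r, (h r).IsSymm) :
    ∑ r : Fin p, ∑ i : Fin n, ∑ j : Fin n,
        (if i < j then (h r i i - h r j j) ^ 2 else 0)
      + 2 * (n : ℝ) * ∑ r : Fin p, ∑ i : Fin n, ∑ j : Fin n,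
          (if i < j then h r i j ^ 2 else 0) ≥
    2 * (n : ℝ) * Real.sqrt
      (∑ r : Fin p, ∑ s : Fin p, ∑ i : Fin n, ∑ j : Fin n,
        if r < s ∧ i < j then
          (∑ k : Fin n, (h r j k * h s i k - h r i k * h s j k)) ^ 2
        else 0) := by
  have : Nonempty (Fin n) := ⟨⟨0, by omega⟩⟩
  set c : Fin p → ℝ := fun r => trace (h r) / n
  set B : Fin p → Matrix (Fin n) (Fin n) ℝ := fun r => h r - c r • 1 with hB
  have hBsymm : ∀ r, (B r).IsSymm := fun r => by
    simp only [hB, IsSymm, transpose_sub, transpose_smul, transpose_one, (hsymm r).eq]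
  have hlhs : ∑ r, ∑ i, ∑ j, (if i < j then (h r i i - h r j j) ^ 2 else 0)
      + 2 * (n : ℝ) * ∑ r, ∑ i, ∑ j, (if i < j then h r i j ^ 2 else 0)
      = n * ∑ r, frobSq (B r) := by
    rw [mul_sum, mul_sum, ← sum_add_distrib]
    refine sum_congr rfl fun r _ => ?_
    simpa only [Fintype.card_fin] using (card_mul_frobSq_traceless (hsymm r)).symm
  have hlie : ∀ r s i j, ∑ k, (h r j k * h s i k - h r i k * h s j k) = ⁅B s, B r⁆ i j := by
    intro r s i j
    rw [hB, lie_sub_smul_one, Ring.lie_def, Matrix.sub_apply, mul_apply, mul_apply,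
      ← sum_sub_distrib]
    refine sum_congr rfl fun k _ => ?_
    rw [(hsymm r).apply k j, (hsymm s).apply k j, mul_comm]
  have hsq : ∀ r s i j, (∑ k, (h r j k * h s i k - h r i k * h s j k)) ^ 2
      = ⁅B r, B s⁆ i j ^ 2 := fun r s i j => by
    rw [hlie, ← lie_skew, Matrix.neg_apply, neg_sq]
  have hfour := four_mul_sum_lt_sq_lie_apply hBsymm
  have hddvv := sum_sum_frobSq_lie_le hBsymm
  have hnonneg : 0 ≤ ∑ r, frobSq (B r) := sum_nonneg fun r _ => frobSq_nonneg _
  simp only [hsq]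
  rw [ge_iff_le, hlhs]
  have hsqrt := Real.sqrt_le_iff.2 ⟨by positivity, (by linarith :
    ∑ r, ∑ s, ∑ i, ∑ j, (if r < s ∧ i < j then ⁅B r, B s⁆ i j ^ 2 else 0)
      ≤ ((∑ r, frobSq (B r)) / 2) ^ 2)⟩
  nlinarith [mul_le_mul_of_nonneg_left hsqrt (Nat.cast_nonneg (α := ℝ) n)]
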